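/- arXiv:2101.06303 — 2 statements merged into one kernel-verified Lean document; each statement's English description precedes it below -/
import Mathlib

section
/- Let p be an odd prime, and define the trace of Frobenius a(λ) = −Σ_{x ∈ F_p} φ(x(x−1)(x−λ)) for λ ∈ F_p \ {0,1}, where φ is the quadratic character. Then the number of affine F_p-points on y² = x(x−1)(x−λ) equals p − a(λ), and |a(λ)| ≤ 2√p. -/
open Polynomial

namespace LegendreHasse

/-- The integer argument: an integral quadratic progression of naturals has small discriminant. -/
lemma int_part (p : ℕ) (hodd : p % 2 = 1) (a : ℤ) (d : ℤ → ℕ)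
    (hstep : ∀ n, (d (n + 1) : ℤ) + d (n - 1) = 2 * d n + 2)
    (h0 : d 0 = p) (hm : (d (-1) : ℤ) = p + 1 - a) : a ^ 2 ≤ 4 * p := by
  have key : ∀ n : ℤ, (d n : ℤ) = n ^ 2 + a * n + p ∧
      (d (n - 1) : ℤ) = (n - 1) ^ 2 + a * (n - 1) + p := by
    intro n
    induction n using Int.induction_on with
    | zero =>
      refine ⟨by simp [h0], ?_⟩
      rw [zero_sub, hm]; ring
    | succ i ih =>
      obtain ⟨h1, h2⟩ := ih
      have := hstep i
      refine ⟨?_, ?_⟩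
      · linear_combination this - h2 + 2 * h1
      · rw [add_sub_cancel_right]; exact h1
    | pred i ih =>
      obtain ⟨h1, h2⟩ := ih
      have := hstep (-i - 1)
      rw [sub_add_cancel] at this
      refine ⟨h2, ?_⟩
      linear_combination this - h1 + 2 * h2
  obtain ⟨k, hk | hk⟩ := Int.even_or_odd' a
  · have h := (key (-k)).1
    have h' : (0 : ℤ) ≤ d (-k) := by positivity
    subst hk
    nlinarith
  · have h := (key (-k)).1
    have h' : (0 : ℤ) ≤ d (-k) := by positivity
    have e : (d (-k) : ℤ) = p - k * (k + 1) := by rw [h, hk]; ring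
    have hne : (d (-k) : ℤ) ≠ 0 := by
      intro h0
      have hev := Int.even_mul_succ_self k
      rw [show k * (k + 1) = (p : ℤ) by linarith] at hev
      obtain ⟨m, hm⟩ := hev
      omega
    have : (1 : ℤ) ≤ d (-k) := by omega
    rw [hk]
    nlinarith

section curve
variable {K : Type*} [Field K] [DecidableEq K]

/-- The curve `Y² = X³ + a X² + b X`. -/
def W (a b : K) : WeierstrassCurve.Affine K := ⟨0, a, 0, b, 0⟩

open WeierstrassCurve.Affine

lemma sub_xRep (a b X1 Y1 X2 Y2 : K) (hP : (W a b).Nonsingular X1 Y1)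
    (hQ : (W a b).Nonsingular X2 Y2) (hX : X1 ≠ X2) :
    (Point.some X1 Y1 hP - Point.some X2 Y2 hQ).xRep =
      ![((Y1 + Y2) / (X1 - X2)) ^ 2 - a - X1 - X2, 1] := by
  have hnY : ∀ x y, (W a b).negY x y = -y := by intro x y; simp [W, negY]
  rw [sub_eq_add_neg (Point.some X1 Y1 hP), Point.neg_some, Point.add_of_X_ne hX]
  simp only [Point.xRep_some, slope_of_X_ne hX, hnY]
  simp [addX, W]

lemma addsub (h2 : (2 : K) ≠ 0) (a b X2 Y2 : K) (hQ : (W a b).Nonsingular X2 Y2) (hY : Y2 ≠ 0)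
    (P : (W a b).Point) :
    ∃ c : K, c ≠ 0 ∧
      (P + Point.some X2 Y2 hQ).xRep 0 * (P - Point.some X2 Y2 hQ).xRep 0
        = c * (P.xRep 0 * X2 - b * P.xRep 1) ^ 2 ∧
      (P + Point.some X2 Y2 hQ).xRep 0 * (P - Point.some X2 Y2 hQ).xRep 1
        + (P - Point.some X2 Y2 hQ).xRep 0 * (P + Point.some X2 Y2 hQ).xRep 1
        = c * (2 * ((P.xRep 0 * X2 + b * P.xRep 1) * (P.xRep 0 + X2 * P.xRep 1)
            + 2 * a * P.xRep 0 * X2 * P.xRep 1)) ∧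
      (P + Point.some X2 Y2 hQ).xRep 1 * (P - Point.some X2 Y2 hQ).xRep 1
        = c * (P.xRep 0 - X2 * P.xRep 1) ^ 2 := by
  have hE := (equation_iff _ _).1 hQ.1
  simp only [W] at hE
  have hnY : ∀ x y, (W a b).negY x y = -y := by intro x y; simp [W, negY]
  have hYne : Y2 ≠ (W a b).negY X2 Y2 := by
    rw [hnY]; intro h; apply hY
    have : 2 * Y2 = 0 := by linear_combination h
    simpa [h2] using this
  -- doubling
  have hdbl : ∃ X3 Y3 h3, Point.some X2 Y2 hQ + Point.some X2 Y2 hQ = Point.some X3 Y3 h3 ∧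
      X3 * (4 * Y2 ^ 2) = (X2 ^ 2 - b) ^ 2 := by
    refine ⟨_, _, _, Point.add_self_of_Y_ne hYne, ?_⟩
    rw [slope_of_Y_ne rfl hYne, hnY]
    simp only [addX, W]
    have : Y2 - -Y2 = 2 * Y2 := by ring
    rw [this]
    field_simp
    ring_nf
    ring_nf at hE
    rw [hE]
    ring
  obtain ⟨X3, Y3, h3, hd, hX3⟩ := hdbl
  match P with
  | 0 =>
    refine ⟨1, one_ne_zero, ?_, ?_, ?_⟩ <;> simp [Point.xRep] <;> ring
  | .some X1 Y1 hP =>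
    by_cases hX : X1 = X2
    · rcases (Point.X_eq_iff (h₁ := hP) (h₂ := hQ)).1 hX with h | h
      · rw [h, sub_self, hd]
        refine ⟨(4 * Y2 ^ 2)⁻¹, ?_, ?_, ?_, ?_⟩
        · have : (4 : K) = 2 * 2 := by norm_num
          rw [this]
          simp [h2, hY]
        all_goals
          have h4 : (4 : K) ≠ 0 := by
            have : (4 : K) = 2 * 2 := by norm_num
            rw [this]; simp [h2]
          simp [Point.xRep]
          try field_simp
          try linear_combination hX3
          try linear_combination 4 * hE
      · have e : -Point.some X2 Y2 hQ - Point.some X2 Y2 hQ = - Point.some X3 Y3 h3 := by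
          rw [← hd]; abel
        rw [h, neg_add_cancel, e]
        refine ⟨(4 * Y2 ^ 2)⁻¹, ?_, ?_, ?_, ?_⟩
        · have : (4 : K) = 2 * 2 := by norm_num
          rw [this]
          simp [h2, hY]
        all_goals
          have h4 : (4 : K) ≠ 0 := by
            have : (4 : K) = 2 * 2 := by norm_num
            rw [this]; simp [h2]
          simp only [Point.xRep_neg]
          simp [Point.xRep]
          try field_simp
          try linear_combination hX3
          try linear_combination 4 * hE
    · have hE1 := (equation_iff _ _).1 hP.1
      simp only [W] at hE1
      have hs : X1 - X2 ≠ 0 := sub_ne_zero.2 hX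
      rw [sub_eq_add_neg (Point.some X1 Y1 hP), Point.neg_some,
        Point.add_of_X_ne hX, Point.add_of_X_ne hX]
      refine ⟨((X1 - X2) ^ 2)⁻¹, by simp [hs], ?_, ?_, ?_⟩
      · simp only [Point.xRep_some, slope_of_X_ne hX, hnY]
        simp [addX, W]
        field_simp
        have e1 : Y1 ^ 2 = X1 ^ 3 + a * X1 ^ 2 + b * X1 := by linear_combination hE1
        have e2 : Y2 ^ 2 = X2 ^ 3 + a * X2 ^ 2 + b * X2 := by linear_combination hE
        grind
      · simp only [Point.xRep_some, slope_of_X_ne hX, hnY]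
        simp [addX, W]
        field_simp
        linear_combination 2 * hE1 + 2 * hE
      · simp [Point.xRep, hs]

end curve
end LegendreHasse

namespace LegendreHasse

section gauss
variable {k : Type*} [Field k]

/-- A triple of polynomials without common prime factor. -/
def Prim (T : Fin 3 → k[X]) : Prop := ∀ π : k[X], Prime π → ¬ ∀ i, π ∣ T i

/-- The maximum of the degrees is `N`. -/
def Top (T : Fin 3 → k[X]) (N : ℕ) : Prop := (∀ i, (T i).natDegree ≤ N) ∧ ∃ i, (T i).coeff N ≠ 0

lemma Top.unique {T : Fin 3 → k[X]} {N M : ℕ} (h : Top T N) (h' : Top T M) : N = M := by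
  obtain ⟨h1, i, hi⟩ := h
  obtain ⟨h2, j, hj⟩ := h'
  exact le_antisymm ((le_natDegree_of_ne_zero hi).trans (h2 i))
    ((le_natDegree_of_ne_zero hj).trans (h1 j))

lemma Top.smul {T S : Fin 3 → k[X]} {N : ℕ} {c : k} (hc : c ≠ 0) (h : Top S N)
    (hT : ∀ i, T i = C c * S i) : Top T N := by
  obtain ⟨h1, i, hi⟩ := h
  refine ⟨fun j => ?_, i, ?_⟩
  · rw [hT]; exact (natDegree_C_mul_le _ _).trans (h1 j)
  · rw [hT, coeff_C_mul]; exact mul_ne_zero hc hi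

lemma isUnit_of_dvd_prim {T : Fin 3 → k[X]} (hT : Prim T) {q : k[X]} (hq : q ≠ 0)
    (h : ∀ i, q ∣ T i) : IsUnit q := by
  by_contra hu
  obtain ⟨π, hπ, hd⟩ := WfDvdMonoid.exists_irreducible_factor hu hq
  exact hT π hπ.prime fun i => hd.trans (h i)

lemma prop_deg {T S : Fin 3 → k[X]} {N M : ℕ} (hT : Prim T) (hS : Prim S)
    (tT : Top T N) (tS : Top S M) (e : RatFunc k) (he : e ≠ 0)
    (h : ∀ i, algebraMap k[X] (RatFunc k) (T i) = e * algebraMap k[X] (RatFunc k) (S i)) :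
    N = M := by
  have hd : algebraMap k[X] (RatFunc k) e.denom ≠ 0 := by
    simpa using e.denom_ne_zero
  have hpoly : ∀ i, e.denom * T i = e.num * S i := by
    intro i
    apply FaithfulSMul.algebraMap_injective k[X] (RatFunc k)
    rw [map_mul, map_mul, h i]
    conv_lhs => rw [← RatFunc.num_div_denom e]
    rw [RatFunc.num_div_denom e]
    nth_rewrite 2 [← RatFunc.num_div_denom e]
    field_simp
  have hn : e.num ≠ 0 := RatFunc.num_ne_zero he
  have hcop := e.isCoprime_num_denom
  have u1 : IsUnit e.denom := isUnit_of_dvd_prim hS e.denom_ne_zero fun i =>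
    hcop.symm.dvd_of_dvd_mul_left (Dvd.intro _ (hpoly i))
  have u2 : IsUnit e.num := isUnit_of_dvd_prim hT hn fun i =>
    hcop.dvd_of_dvd_mul_left (Dvd.intro _ (hpoly i).symm)
  obtain ⟨a, ha, ea⟩ := Polynomial.isUnit_iff.1 u1
  obtain ⟨b, hb, eb⟩ := Polynomial.isUnit_iff.1 u2
  have ha := ha.ne_zero
  have hb := hb.ne_zero
  have t1 : Top (fun i => C a * T i) N := tT.smul ha fun i => rfl
  have t2 : Top (fun i => C b * S i) M := tS.smul hb fun i => rfl
  have : (fun i => C a * T i) = (fun i => C b * S i) := by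
    funext i; rw [ea, eb]; exact hpoly i
  rw [this] at t1
  exact t1.unique t2

lemma prim_prod {A B A' B' : k[X]} (h : IsCoprime A B) (h' : IsCoprime A' B') :
    Prim ![A * A', A * B' + A' * B, B * B'] := by
  intro π hπ H
  have H0 : π ∣ A * A' := H 0
  have H1 : π ∣ A * B' + A' * B := H 1
  have H2 : π ∣ B * B' := H 2
  have n1 : ¬ (π ∣ A ∧ π ∣ B) := fun ⟨x, y⟩ => hπ.not_isUnit (h.isUnit_of_dvd' x y)
  have n2 : ¬ (π ∣ A' ∧ π ∣ B') := fun ⟨x, y⟩ => hπ.not_isUnit (h'.isUnit_of_dvd' x y)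
  rcases hπ.dvd_or_dvd H0 with a | a <;> rcases hπ.dvd_or_dvd H2 with b | b
  · exact n1 ⟨a, b⟩
  · have := (dvd_add_right (a.mul_right B')).1 H1
    rcases hπ.dvd_or_dvd this with c | c
    · exact n2 ⟨c, b⟩
    · exact n1 ⟨a, c⟩
  · have := (dvd_add_left (a.mul_right B)).1 H1
    rcases hπ.dvd_or_dvd this with c | c
    · exact n1 ⟨c, b⟩
    · exact n2 ⟨a, c⟩
  · exact n2 ⟨a, b⟩

lemma top_prod {A B A' B' : k[X]} {d d' : ℕ} (hA : A.natDegree ≤ d) (hB : B.natDegree ≤ d)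
    (h : A.coeff d ≠ 0 ∨ B.coeff d ≠ 0) (hA' : A'.natDegree ≤ d') (hB' : B'.natDegree ≤ d')
    (h' : A'.coeff d' ≠ 0 ∨ B'.coeff d' ≠ 0) :
    Top ![A * A', A * B' + A' * B, B * B'] (d + d') := by
  have c0 : (A * A').coeff (d + d') = _ := coeff_mul_add_eq_of_natDegree_le hA hA'
  have c2 : (B * B').coeff (d + d') = _ := coeff_mul_add_eq_of_natDegree_le hB hB'
  have c1 : (A * B').coeff (d + d') = _ := coeff_mul_add_eq_of_natDegree_le hA hB'
  have c1' : (A' * B).coeff (d + d') = A'.coeff d' * B.coeff d := by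
    rw [mul_comm A', coeff_mul_add_eq_of_natDegree_le hB hA', mul_comm]
  constructor
  · intro i
    fin_cases i
    · exact natDegree_mul_le_of_le hA hA'
    · refine natDegree_add_le_of_degree_le (natDegree_mul_le_of_le hA hB') ?_
      rw [mul_comm A']; exact (natDegree_mul_le_of_le hB hA')
    · exact natDegree_mul_le_of_le hB hB'
  · by_contra! H
    have H0 : (A * A').coeff (d + d') = 0 := H 0
    have H1 : (A * B' + A' * B).coeff (d + d') = 0 := H 1
    have H2 : (B * B').coeff (d + d') = 0 := H 2
    rw [c0] at H0
    rw [coeff_add, c1, c1'] at H1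
    rw [c2] at H2
    grind

/-- The triple describing the sum and difference with the base point. -/
noncomputable def tr (l : k) (A B : k[X]) : Fin 3 → k[X] :=
  ![(A * X - C l * B) ^ 2,
    2 * ((A * X + C l * B) * (A + X * B) + 2 * (-(1 + C l)) * A * X * B),
    (A - X * B) ^ 2]

lemma prim_tr (h2 : (2 : k) ≠ 0) {l : k} (h0 : l ≠ 0) (h1 : l ≠ 1) {A B : k[X]}
    (h : IsCoprime A B) : Prim (tr l A B) := by
  intro π hπ H
  have H0 : π ∣ (A * X - C l * B) ^ 2 := H 0
  have H1 : π ∣ 2 * ((A * X + C l * B) * (A + X * B) + 2 * (-(1 + C l)) * A * X * B) := H 1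
  have H2 : π ∣ (A - X * B) ^ 2 := H 2
  replace H0 := hπ.dvd_of_dvd_pow H0
  replace H2 := hπ.dvd_of_dvd_pow H2
  have hC : ∀ c : k, c ≠ 0 → ¬ π ∣ C c := fun c hc hd =>
    hπ.not_isUnit (isUnit_of_dvd_unit hd (by simpa using hc))
  have h2' : ¬ π ∣ (2 : k[X]) := by
    have := hC 2 h2
    rwa [map_ofNat] at this
  have hB : ¬ π ∣ B := by
    intro hB
    have : π ∣ A := by
      have := dvd_add H2 (hB.mul_left X)
      rwa [sub_add_cancel] at this
    exact hπ.not_isUnit (h.isUnit_of_dvd' this hB)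
  have hXl : π ∣ X ^ 2 - C l := by
    have : π ∣ (X ^ 2 - C l) * B := by
      have := dvd_sub H0 (H2.mul_left X)
      convert this using 1; ring
    exact (hπ.dvd_or_dvd this).resolve_right hB
  have H1' := (hπ.dvd_or_dvd H1).resolve_left h2'
  have key : π ∣ 2 * (B ^ 2 * (X ^ 2 * (X - 1) ^ 2)) := by
    obtain ⟨u, hu⟩ := H2
    obtain ⟨v, hv⟩ := hXl
    obtain ⟨w, hw⟩ := H1'
    have eA : A = X * B + π * u := by linear_combination hu
    have el : C l = X ^ 2 - π * v := by linear_combination -hv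
    rw [eA, el] at hw
    have : 2 * (B ^ 2 * (X ^ 2 * (X - 1) ^ 2)) = π * (-w + (((X * B + π * u) * X + (X ^ 2 - π * v) * B) * u
       + (X * u - v * B) * (2 * X * B) + 2 * v * (X * B + π * u) * X * B - 2 * (1 + X ^ 2) * u * X * B)) := by
      linear_combination -hw
    rw [this]; exact dvd_mul_right _ _
  have key := (hπ.dvd_or_dvd key).resolve_left h2'
  have key := (hπ.dvd_or_dvd key).resolve_left fun h => hB (hπ.dvd_of_dvd_pow h)
  rcases hπ.dvd_or_dvd key with h | h
  · have h := hπ.dvd_of_dvd_pow h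
    apply hC l h0
    have := dvd_sub (h.mul_left X) hXl
    convert this using 1; ring
  · have h := hπ.dvd_of_dvd_pow h
    apply hC (1 - l) (sub_ne_zero.2 h1.symm)
    have := dvd_sub hXl (h.mul_left (X + 1))
    convert this using 1
    rw [C_sub, C_1]; ring

lemma top_tr (l : k) {A B : k[X]} {d : ℕ} (hA : A.natDegree ≤ d) (hB : B.natDegree ≤ d)
    (h : A.coeff d ≠ 0 ∨ B.coeff d ≠ 0) : Top (tr l A B) (2 * d + 2) := by
  have e : 2 * d + 2 = 2 * (d + 1) := by ring
  have hAX : (A * X).natDegree ≤ d + 1 := natDegree_mul_le_of_le hA natDegree_X_le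
  have hXB : (X * B).natDegree ≤ d + 1 := by
    rw [mul_comm]; exact natDegree_mul_le_of_le hB natDegree_X_le
  have hlB : (C l * B).natDegree ≤ d := (natDegree_C_mul_le _ _).trans hB
  have h1 : (A * X - C l * B).natDegree ≤ d + 1 :=
    natDegree_sub_le_of_le hAX (by omega) |>.trans (by simp)
  have h1' : (A * X + C l * B).natDegree ≤ d + 1 :=
    natDegree_add_le_of_degree_le hAX (by omega)
  have h3 : (A - X * B).natDegree ≤ d + 1 :=
    natDegree_sub_le_of_le (m := d + 1) (by omega) hXB |>.trans (by simp)
  have h3' : (A + X * B).natDegree ≤ d + 1 :=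
    natDegree_add_le_of_degree_le (by omega) hXB
  rw [e]
  constructor
  · intro i
    fin_cases i
    · exact natDegree_pow_le_of_le 2 h1
    · show (2 * ((A * X + C l * B) * (A + X * B) + 2 * (-(1 + C l)) * A * X * B)).natDegree ≤ _
      have e2 : 2 * ((A * X + C l * B) * (A + X * B) + 2 * (-(1 + C l)) * A * X * B)
        = C 2 * ((A * X + C l * B) * (A + X * B) + C (2 * (-(1 + l))) * ((A * X) * B)) := by
        simp only [C_mul, C_neg, C_add, C_1, map_ofNat]; ring
      rw [e2]
      refine (natDegree_C_mul_le _ _).trans (natDegree_add_le_of_degree_le ?_ ?_)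
      · exact (natDegree_mul_le_of_le h1' h3').trans (by omega)
      · exact (natDegree_C_mul_le _ _).trans ((natDegree_mul_le_of_le hAX hB).trans (by omega))
    · exact natDegree_pow_le_of_le 2 h3
  · have cl : (C l * B).coeff (d + 1) = 0 := coeff_eq_zero_of_natDegree_lt (by omega)
    have cA : A.coeff (d + 1) = 0 := coeff_eq_zero_of_natDegree_lt (by omega)
    rcases h with h | h
    · refine ⟨0, ?_⟩
      show ((A * X - C l * B) ^ 2).coeff _ ≠ 0
      rw [coeff_pow_of_natDegree_le h1, coeff_sub, cl, coeff_mul_X, sub_zero]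
      exact pow_ne_zero _ h
    · refine ⟨2, ?_⟩
      show ((A - X * B) ^ 2).coeff _ ≠ 0
      rw [coeff_pow_of_natDegree_le h3, coeff_sub, cA, coeff_X_mul, zero_sub]
      exact pow_ne_zero _ (neg_ne_zero.2 h)

end gauss
end LegendreHasse

namespace LegendreHasse
section heights
variable {k : Type*} [Field k]
open WeierstrassCurve.Affine

/-- The Legendre cubic. -/
noncomputable def cub (l : k) : k[X] := X * (X - 1) * (X - C l)

/-- The embedding of polynomials in rational functions. -/
noncomputable abbrev io : k[X] →+* RatFunc k := algebraMap k[X] (RatFunc k)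

lemma io_inj : Function.Injective (io : k[X] →+* RatFunc k) :=
  FaithfulSMul.algebraMap_injective k[X] (RatFunc k)

lemma io_ne {q : k[X]} (h : q ≠ 0) : io q ≠ 0 := by
  simpa [io] using h

lemma cub_ne (l : k) : cub l ≠ 0 := by
  unfold cub
  refine mul_ne_zero (mul_ne_zero X_ne_zero ?_) (X_sub_C_ne_zero l)
  simpa using X_sub_C_ne_zero (1 : k)

/-- The twisted Legendre curve. -/
noncomputable abbrev E (l : k) : WeierstrassCurve.Affine (RatFunc k) :=
  W (io (-(1 + C l) * cub l)) (io (C l * cub l ^ 2))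

/-- The untwisted `x`-coordinate of `P` has height `d`. -/
def HasHt (l : k) (P : (E l).Point) (d : ℕ) : Prop :=
  ∃ A B : k[X], IsCoprime A B ∧ A.natDegree ≤ d ∧ B.natDegree ≤ d ∧
    (A.coeff d ≠ 0 ∨ B.coeff d ≠ 0) ∧
    ∃ c : RatFunc k, c ≠ 0 ∧ P.xRep 0 = c * io (cub l) * io A ∧ P.xRep 1 = c * io B

lemma exists_ht (l : k) (P : (E l).Point) : ∃ d, HasHt l P d := by
  have hf := io_ne (cub_ne l)
  match P with
  | 0 =>
    refine ⟨0, 1, 0, isCoprime_one_left, by simp, by simp, by simp, (io (cub l))⁻¹,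
      inv_ne_zero hf, ?_, ?_⟩
    · simp [hf]
    · simp
  | .some x y h =>
    set r : RatFunc k := x / io (cub l) with hr
    have hd : io r.denom ≠ 0 := io_ne r.denom_ne_zero
    refine ⟨max r.num.natDegree r.denom.natDegree, r.num, r.denom, r.isCoprime_num_denom,
      le_max_left _ _, le_max_right _ _, ?_, (io r.denom)⁻¹, inv_ne_zero hd, ?_, ?_⟩
    · rcases le_total r.num.natDegree r.denom.natDegree with h | h
      · right
        rw [max_eq_right h]
        simpa using r.denom_ne_zero
      · rw [max_eq_left h]
        by_cases hn : r.num = 0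
        · right
          rw [hn, natDegree_zero] at h ⊢
          rw [← Nat.le_zero.1 h]
          simpa using r.denom_ne_zero
        · left
          simpa using hn
    · have := RatFunc.num_div_denom r
      have h2 : x = r * io (cub l) := by rw [hr]; field_simp
      have h3 : io r.num = r * io r.denom := by
        nth_rewrite 2 [← this]
        exact (div_mul_cancel₀ _ hd).symm
      rw [h3]
      simp only [Point.xRep_some, Matrix.cons_val_zero]
      rw [h2]; field_simp
    · simp [hd]

lemma ht_unique (l : k) (P : (E l).Point) {d d' : ℕ} (h : HasHt l P d) (h' : HasHt l P d') :
    d = d' := by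
  obtain ⟨A, B, hc, hA, hB, ht, c, c0, e1, e2⟩ := h
  obtain ⟨A', B', hc', hA', hB', ht', c', c0', e1', e2'⟩ := h'
  have hf := io_ne (cub_ne l)
  have prim : ∀ {A B : k[X]}, IsCoprime A B → Prim ![A, B, 0] := by
    intro A B h π hπ H
    exact hπ.not_isUnit (h.isUnit_of_dvd' (H 0) (H 1))
  have top : ∀ {A B : k[X]} {d}, A.natDegree ≤ d → B.natDegree ≤ d →
      (A.coeff d ≠ 0 ∨ B.coeff d ≠ 0) → Top ![A, B, 0] d := by
    intro A B d h1 h2 h3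
    refine ⟨fun i => ?_, ?_⟩
    · fin_cases i
      · exact h1
      · exact h2
      · simp
    · rcases h3 with h | h
      · exact ⟨0, h⟩
      · exact ⟨1, h⟩
  refine prop_deg (prim hc) (prim hc') (top hA hB ht) (top hA' hB' ht') (c' / c)
    (div_ne_zero c0' c0) ?_
  rw [e1] at e1'
  rw [e2] at e2'
  intro i
  fin_cases i
  · show io A = _ * io A'
    field_simp
    apply mul_left_cancel₀ hf
    linear_combination e1'
  · show io B = _ * io B'
    field_simp
    linear_combination e2'
  · simp

variable [DecidableEq (RatFunc k)] in
lemma ht_step (h2 : (2 : k) ≠ 0) {l : k} (h0 : l ≠ 0) (h1 : l ≠ 1)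
    (hQ : (E l).Nonsingular (io (cub l * X)) (io (cub l ^ 2)))
    (P : (E l).Point) {d d₁ d₂ : ℕ} (h : HasHt l P d)
    (hp : HasHt l (P + Point.some _ _ hQ) d₁) (hm : HasHt l (P - Point.some _ _ hQ) d₂) :
    d₁ + d₂ = 2 * d + 2 := by
  have hf := io_ne (cub_ne l)
  have h2' : (2 : RatFunc k) ≠ 0 := by
    have h2X : (2 : k[X]) ≠ 0 := by
      rw [← map_ofNat C 2]; simpa using h2
    have := io_ne h2X
    rwa [map_ofNat] at this
  obtain ⟨g, hg, g0, g1, g2⟩ := addsub h2' _ _ _ _ hQ (io_ne (pow_ne_zero 2 (cub_ne l))) P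
  obtain ⟨A, B, hc, hA, hB, ht, c, c0, e1, e2⟩ := h
  obtain ⟨A1, B1, hc1, hA1, hB1, ht1, c1, c01, e11, e21⟩ := hp
  obtain ⟨A2, B2, hc2, hA2, hB2, ht2, c2, c02, e12, e22⟩ := hm
  rw [e11, e12, e1, e2] at g0
  rw [e11, e12, e1, e2, e21, e22] at g1
  rw [e1, e2, e21, e22] at g2
  refine prop_deg (prim_prod hc1 hc2) (prim_tr h2 h0 h1 hc) (top_prod hA1 hB1 ht1 hA2 hB2 ht2)
    (top_tr l hA hB ht) (g * c ^ 2 * io (cub l) ^ 2 / (c1 * c2)) ?_ ?_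
  · positivity
  intro i
  simp only [map_mul, map_neg, map_add, map_one, map_pow] at g0 g1 g2
  fin_cases i
  · show io (A1 * A2) = _ * io ((A * X - C l * B) ^ 2)
    simp only [map_mul, map_neg, map_add, map_one, map_pow, map_sub]
    field_simp
    apply mul_left_cancel₀ (pow_ne_zero 2 hf)
    linear_combination g0
  · show io (A1 * B2 + A2 * B1) = _ * io (2 * ((A * X + C l * B) * (A + X * B) + 2 * (-(1 + C l)) * A * X * B))
    simp only [map_mul, map_neg, map_add, map_one, map_pow, map_sub, map_ofNat]
    field_simp
    apply mul_left_cancel₀ hf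
    linear_combination g1
  · show io (B1 * B2) = _ * io ((A - X * B) ^ 2)
    simp only [map_mul, map_neg, map_add, map_one, map_pow, map_sub]
    field_simp
    linear_combination g2

lemma nonsing (h2 : (2 : k) ≠ 0) (l : k) {x y : RatFunc k} (hy : y ≠ 0)
    (h : y ^ 2 = x ^ 3 + io (-(1 + C l) * cub l) * x ^ 2 + io (C l * cub l ^ 2) * x) :
    (E l).Nonsingular x y := by
  have h2' : (2 : RatFunc k) ≠ 0 := by
    have h2X : (2 : k[X]) ≠ 0 := by
      rw [← map_ofNat C 2]; simpa using h2
    have := io_ne h2X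
    rwa [map_ofNat] at this
  rw [nonsingular_iff', equation_iff]
  simp only [E, W]
  refine ⟨by linear_combination h, Or.inr ?_⟩
  simpa using ⟨h2', hy⟩

end heights
end LegendreHasse

namespace LegendreHasse
section base
open WeierstrassCurve.Affine
variable {p : ℕ} [Fact p.Prime]

/-- Elements at which the cubic has quadratic character `e`. -/
noncomputable def lev (l : ZMod p) (e : ℤ) : Finset (ZMod p) :=
  Finset.univ.filter fun x => quadraticChar (ZMod p) (x * (x - 1) * (x - l)) = e

/-- The corresponding product. -/
noncomputable def gp (l : ZMod p) (e : ℤ) : (ZMod p)[X] := ∏ x ∈ lev l e, (X - C x)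

lemma gp_monic (l : ZMod p) (e : ℤ) : (gp l e).Monic := monic_prod_X_sub_C _ _

lemma gp_deg (l : ZMod p) (e : ℤ) : (gp l e).natDegree = (lev l e).card := by
  simp [gp]

lemma prod_lev {M : Type*} [CommMonoid M] (l : ZMod p) (g : ZMod p → M) :
    ∏ x, g x = (∏ x ∈ lev l 0, g x) * (∏ x ∈ lev l 1, g x) * ∏ x ∈ lev l (-1), g x := by
  classical
  have hu : (Finset.univ : Finset (ZMod p)) = (lev l 0 ∪ lev l 1) ∪ lev l (-1) := by
    ext x
    simp only [lev, Finset.mem_univ, Finset.mem_union, Finset.mem_filter, true_and, true_iff]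
    by_cases h : x * (x - 1) * (x - l) = 0
    · simp [h]
    · rcases quadraticChar_dichotomy h with h | h <;> simp [h]
  rw [hu, Finset.prod_union, Finset.prod_union]
  · rw [Finset.disjoint_left]
    intro x hx hx'
    simp only [lev, Finset.mem_filter, Finset.mem_univ, true_and] at hx hx'
    omega
  · rw [Finset.disjoint_left]
    intro x hx hx'
    simp only [lev, Finset.mem_union, Finset.mem_filter, Finset.mem_univ, true_and] at hx hx'
    omega

lemma lev_zero (l : ZMod p) : lev l 0 = {0, 1, l} := by
  ext x
  simp only [lev, Finset.mem_filter, Finset.mem_univ, true_and, quadraticChar_eq_zero_iff,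
    Finset.mem_insert, Finset.mem_singleton, mul_eq_zero, sub_eq_zero, or_assoc]

lemma gp_zero (l : ZMod p) (h0 : l ≠ 0) (h1 : l ≠ 1) : gp l 0 = cub l := by
  rw [gp, lev_zero, Finset.prod_insert, Finset.prod_insert, Finset.prod_singleton, cub]
  · simp; ring
  · simpa using h1.symm
  · simpa using h0.symm

lemma lev_zero_card (l : ZMod p) (h0 : l ≠ 0) (h1 : l ≠ 1) : (lev l 0).card = 3 := by
  rw [lev_zero, Finset.card_eq_three]
  exact ⟨0, 1, l, zero_ne_one, h0.symm, h1.symm, rfl⟩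

lemma prod_all : ∏ x : ZMod p, (X - C x) = (X ^ p - X : (ZMod p)[X]) := by
  have hp1 : 1 < p := (Fact.out : p.Prime).one_lt
  have hr := FiniteField.roots_X_pow_card_sub_X (ZMod p)
  rw [ZMod.card] at hr
  have hm : (X ^ p - X : (ZMod p)[X]).Monic := by
    apply monic_X_pow_sub
    rw [degree_X]; exact_mod_cast hp1
  have := prod_multiset_X_sub_C_of_monic_of_roots_card_eq hm (by
    rw [hr, FiniteField.X_pow_card_sub_X_natDegree_eq _ hp1]
    simp)
  rw [hr] at this
  exact this

lemma factor (l : ZMod p) (h0 : l ≠ 0) (h1 : l ≠ 1) :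
    (X ^ p - X : (ZMod p)[X]) = cub l * gp l 1 * gp l (-1) := by
  rw [← prod_all, prod_lev l, ← gp_zero l h0 h1]; rfl

lemma card_sum (l : ZMod p) (h0 : l ≠ 0) (h1 : l ≠ 1) :
    p = 3 + (lev l 1).card + (lev l (-1)).card := by
  have := congrArg natDegree (factor l h0 h1)
  rw [FiniteField.X_pow_card_sub_X_natDegree_eq _ (Fact.out : p.Prime).one_lt,
    ← gp_zero l h0 h1, ((gp_monic l 0).mul (gp_monic l 1)).natDegree_mul (gp_monic l _),
    (gp_monic l 0).natDegree_mul (gp_monic l 1), gp_deg, gp_deg, gp_deg,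
    lev_zero_card l h0 h1] at this
  exact this

lemma char_sum (l : ZMod p) : ∑ x : ZMod p, quadraticChar (ZMod p) (x * (x - 1) * (x - l))
    = ((lev l 1).card : ℤ) - (lev l (-1)).card := by
  have := prod_lev l fun x => Multiplicative.ofAdd (quadraticChar (ZMod p) (x * (x - 1) * (x - l)))
  rw [← ofAdd_sum, ← ofAdd_sum, ← ofAdd_sum, ← ofAdd_sum, ← ofAdd_add, ← ofAdd_add] at this
  rw [Multiplicative.ofAdd.injective this]
  have h : ∀ e : ℤ, ∑ x ∈ lev l e, quadraticChar (ZMod p) (x * (x - 1) * (x - l))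
      = (lev l e).card * e := by
    intro e
    rw [Finset.sum_congr rfl (g := fun _ => e)]
    · simp
    · intro x hx
      simpa [lev] using hx
  rw [h, h, h]; ring

lemma gp_dvd (hp : p ≠ 2) (l : ZMod p) (e : ℤ) :
    gp l e ∣ cub l ^ (p / 2) - C (e : ZMod p) := by
  apply Finset.prod_dvd_of_coprime
  · intro x _ y _ hxy
    exact pairwise_coprime_X_sub_C (s := id) Function.injective_id hxy
  · intro x hx
    rw [dvd_iff_isRoot]
    have hx : quadraticChar (ZMod p) (x * (x - 1) * (x - l)) = e := by simpa [lev] using hx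
    have h2 : ringChar (ZMod p) ≠ 2 := by rwa [ZMod.ringChar_zmod_n]
    have := quadraticChar_eq_pow_of_char_ne_two' h2 (x * (x - 1) * (x - l))
    rw [hx, ZMod.card] at this
    simp [cub, this]

lemma cub_pow (l : ZMod p) : cub l ^ p = X ^ p * (X ^ p - 1) * (X ^ p - C l) := by
  rw [cub, mul_pow, mul_pow, sub_pow_char, sub_pow_char, ← C_pow, ZMod.pow_card, one_pow]

lemma cub_deg (l : ZMod p) (h0 : l ≠ 0) (h1 : l ≠ 1) : (cub l).natDegree = 3 := by
  rw [← gp_zero l h0 h1, gp_deg, lev_zero_card l h0 h1]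

/-- Numerator of the `x`-coordinate of Frobenius minus identity. -/
lemma num_deg (hp : p ≠ 2) (l : ZMod p) (h0 : l ≠ 0) (h1 : l ≠ 1) :
    (cub l * (cub l ^ (p / 2) + 1) ^ 2
      - (-(1 + C l) + X ^ p + X) * (X ^ p - X) ^ 2 : (ZMod p)[X]).natDegree = 2 * p + 1 := by
  have hpp : p.Prime := Fact.out
  have hodd : p % 2 = 1 := hpp.eq_two_or_odd.resolve_left hp
  have h3 : 3 ≤ p := by have := hpp.two_le; omega
  have e1 : cub l ^ (2 * (p / 2) + 1) = X ^ p * (X ^ p - 1) * (X ^ p - C l) := by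
    rw [← cub_pow]; congr 1; omega
  have e : (cub l * (cub l ^ (p / 2) + 1) ^ 2
      - (-(1 + C l) + X ^ p + X) * (X ^ p - X) ^ 2 : (ZMod p)[X])
      = X ^ (2 * p + 1) + (X ^ (p + 2) - X ^ 3 + C (-2 * (1 + l)) * X ^ (p + 1)
        + C (1 + l) * X ^ 2 + C l * X ^ p + C 2 * cub l ^ (p / 2 + 1) + cub l) := by
    simp only [C_mul, C_neg, C_add, C_1, map_ofNat]
    linear_combination e1
  rw [e]
  have hR : (X ^ (p + 2) - X ^ 3 + C (-2 * (1 + l)) * X ^ (p + 1)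
        + C (1 + l) * X ^ 2 + C l * X ^ p + C 2 * cub l ^ (p / 2 + 1) + cub l
        : (ZMod p)[X]).natDegree ≤ 2 * p := by
    have hc := cub_deg l h0 h1
    have hX : ∀ n, n ≤ 2 * p → (X ^ n : (ZMod p)[X]).natDegree ≤ 2 * p := by
      intro n hn; simpa using hn
    refine natDegree_add_le_of_degree_le (natDegree_add_le_of_degree_le
      (natDegree_add_le_of_degree_le (natDegree_add_le_of_degree_le
        (natDegree_add_le_of_degree_le ?_ ?_) ?_) ?_) ?_) ?_
    · exact (natDegree_sub_le_of_le (hX _ (by omega)) (hX _ (by omega))).trans (by simp)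
    · exact (natDegree_C_mul_le _ _).trans (hX _ (by omega))
    · exact (natDegree_C_mul_le _ _).trans (hX _ (by omega))
    · exact (natDegree_C_mul_le _ _).trans (hX _ (by omega))
    · refine (natDegree_C_mul_le _ _).trans (natDegree_pow_le.trans ?_)
      rw [hc]; omega
    · omega
  rw [natDegree_add_eq_left_of_natDegree_lt]
  · simp
  · rw [natDegree_X_pow]; omega

lemma hasse_core (hp : p ≠ 2) (l : ZMod p) (h0 : l ≠ 0) (h1 : l ≠ 1) :
    (-∑ x : ZMod p, quadraticChar (ZMod p) (x * (x - 1) * (x - l))) ^ 2 ≤ 4 * (p : ℤ) := by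
  classical
  have hpp : p.Prime := Fact.out
  have hodd : p % 2 = 1 := hpp.eq_two_or_odd.resolve_left hp
  have h3 : 3 ≤ p := by have := hpp.two_le; omega
  have h2 : (2 : ZMod p) ≠ 0 := by
    have : Fact (2 < p) := ⟨by omega⟩
    have := ZMod.neg_one_ne_one (n := p)
    intro h
    apply this
    linear_combination -h
  have hf := io_ne (cub_ne l)
  have e1 : cub l ^ (2 * (p / 2) + 1) = X ^ p * (X ^ p - 1) * (X ^ p - C l) := by
    rw [← cub_pow]; congr 1; omega
  have hQ : (E l).Nonsingular (io (cub l * X)) (io (cub l ^ 2)) := by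
    apply nonsing h2 l (io_ne (pow_ne_zero 2 (cub_ne l)))
    simp only [← map_pow, ← map_mul, ← map_add]
    congr 1
    have : cub l = X * (X - 1) * (X - C l) := rfl
    linear_combination cub l ^ 3 * this
  have hF : (E l).Nonsingular (io (cub l * X ^ p)) (io (cub l ^ 2 * cub l ^ (p / 2))) := by
    apply nonsing h2 l
      (io_ne (mul_ne_zero (pow_ne_zero 2 (cub_ne l)) (pow_ne_zero _ (cub_ne l))))
    simp only [← map_pow, ← map_mul, ← map_add]
    congr 1
    linear_combination cub l ^ 3 * e1
  set Q : (E l).Point := Point.some _ _ hQ with hQd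
  set F : (E l).Point := Point.some _ _ hF with hFd
  choose d hd using fun n : ℤ => exists_ht l (F + n • Q)
  apply int_part p hodd _ d
  · intro n
    have e1 : F + (n + 1) • Q = F + n • Q + Q := by rw [add_zsmul, one_zsmul, add_assoc]
    have e2 : F + (n - 1) • Q = F + n • Q - Q := by rw [sub_zsmul, one_zsmul, add_sub_assoc, sub_eq_add_neg (n • Q)]
    have := ht_step h2 h0 h1 hQ (F + n • Q) (hd n) (e1 ▸ hd (n + 1)) (e2 ▸ hd (n - 1))
    exact_mod_cast this
  · have h := hd 0
    rw [zero_zsmul, add_zero] at h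
    refine ht_unique l F h ⟨X ^ p, 1, isCoprime_one_right, by simp, by simp, ?_, 1, one_ne_zero,
      ?_, ?_⟩
    · left; simp
    · simp [hFd]
    · simp [hFd]
  · have h := hd (-1)
    rw [neg_smul, one_smul, ← sub_eq_add_neg] at h
    obtain ⟨w, hw⟩ := gp_dvd hp l (-1)
    have hw : cub l ^ (p / 2) + 1 = gp l (-1) * w := by
      rw [← hw]; simp
    obtain ⟨v, hv⟩ := gp_dvd hp l 1
    have hv : cub l ^ (p / 2) - 1 = gp l 1 * v := by
      rw [← hv]; simp
    have hfac := factor l h0 h1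
    set A : (ZMod p)[X] := w ^ 2 - (-(1 + C l) + X ^ p + X) * (cub l * gp l 1 ^ 2) with hA
    set B : (ZMod p)[X] := cub l * gp l 1 ^ 2 with hB
    have hN : cub l * (cub l ^ (p / 2) + 1) ^ 2
      - (-(1 + C l) + X ^ p + X) * (X ^ p - X) ^ 2 = cub l * gp l (-1) ^ 2 * A := by
      rw [hfac, hw, hA, hB]; ring
    have hBm : B.Monic := by
      rw [hB, ← gp_zero l h0 h1]
      exact (gp_monic l 0).mul ((gp_monic l 1).pow 2)
    have hBdeg : B.natDegree = 3 + 2 * (lev l 1).card := by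
      rw [hB, ← gp_zero l h0 h1, (gp_monic l 0).natDegree_mul ((gp_monic l 1).pow 2),
        (gp_monic l 1).natDegree_pow, gp_deg, gp_deg, lev_zero_card l h0 h1]
    have hcard := card_sum l h0 h1
    have hAdeg : A.natDegree = 4 + 2 * (lev l 1).card := by
      have := num_deg hp l h0 h1
      have hm : (cub l * gp l (-1) ^ 2).Monic := by
        rw [← gp_zero l h0 h1]
        exact (gp_monic l 0).mul ((gp_monic l _).pow 2)
      have hA0 : A ≠ 0 := by
        intro h; rw [hN, h] at this; simp at this
      rw [hN, hm.natDegree_mul' hA0, ← gp_zero l h0 h1,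
        (gp_monic l 0).natDegree_mul ((gp_monic l _).pow 2),
        (gp_monic l _).natDegree_pow, gp_deg, gp_deg, lev_zero_card l h0 h1] at this
      omega
    have hcop : IsCoprime A B := by
      have c1 : IsCoprime (cub l ^ (p / 2) + 1) (cub l) := by
        have : p / 2 = (p / 2 - 1) + 1 := by omega
        refine ⟨1, -cub l ^ (p / 2 - 1), ?_⟩
        rw [this, pow_succ, ← this]; simp
      have c2 : IsCoprime (cub l ^ (p / 2) + 1) (gp l 1) := by
        refine ⟨C (2⁻¹), -C (2⁻¹) * v, ?_⟩
        have e : (C (2⁻¹) * 2 : (ZMod p)[X]) = 1 := by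
          rw [← map_ofNat C 2, ← C_mul, inv_mul_cancel₀ h2, C_1]
        linear_combination C (2⁻¹) * hv + e
      rw [hw] at c1 c2
      have cw : IsCoprime (w ^ 2) B :=
        ((c1.of_mul_left_right).mul_right (c2.of_mul_left_right.pow_right)).pow_left
      have := IsCoprime.add_mul_left_left cw (-(-(1 + C l) + X ^ p + X))
      have hAe : A = w ^ 2 + B * -(-(1 + C l) + X ^ p + X) := by rw [hA]; ring
      rw [hAe]; exact this
    have hXp : (X ^ p - X : (ZMod p)[X]) ≠ 0 :=
      FiniteField.X_pow_card_sub_X_ne_zero _ hpp.one_lt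
    have hne : io (cub l * X ^ p) ≠ io (cub l * X) := by
      intro h
      have := mul_left_cancel₀ (cub_ne l) (io_inj h)
      exact hXp (sub_eq_zero.2 this)
    have hres : HasHt l (F - Q) (4 + 2 * (lev l 1).card) := by
      refine ⟨A, B, hcop, hAdeg.le, by omega, ?_, (io B)⁻¹,
        inv_ne_zero (io_ne hBm.ne_zero), ?_, ?_⟩
      · left
        rw [← hAdeg]
        have : A ≠ 0 := by rintro h; rw [h] at hAdeg; simp at hAdeg; omega
        simpa using this
      · rw [hFd, hQd, sub_xRep _ _ _ _ _ _ hF hQ hne]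
        simp only [Matrix.cons_val_zero]
        have hB0 := io_ne hBm.ne_zero
        have hg0 : io (gp l (-1)) ≠ 0 := io_ne (gp_monic l _).ne_zero
        have hX0 := io_ne hXp
        have hD : (X ^ p - X) ^ 2 = cub l * gp l (-1) ^ 2 * B := by rw [hfac, hB]; ring
        have hNB := congrArg io (show (cub l * (cub l ^ (p / 2) + 1) ^ 2
          - (-(1 + C l) + X ^ p + X) * (X ^ p - X) ^ 2) * B = A * (X ^ p - X) ^ 2 by
            rw [hN, hD]; ring)
        have hden : io (cub l * X ^ p) - io (cub l * X) = io (cub l) * io (X ^ p - X) := by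
          rw [← map_sub, ← map_mul]; congr 1; ring
        rw [hden]
        simp only [map_mul, map_add, map_neg, map_one, map_pow] at hNB ⊢
        rw [map_sub] at hNB
        simp only [map_mul, map_add, map_neg, map_one, map_pow] at hNB
        field_simp
        linear_combination hNB
      · rw [hFd, hQd, sub_xRep _ _ _ _ _ _ hF hQ hne]
        have hB0 := io_ne hBm.ne_zero
        simp [hB0]
    have := ht_unique l _ h hres
    rw [this, char_sum]
    push_cast
    omega

lemma point_count (hp : p ≠ 2) (l : ZMod p) :
    (Fintype.card {xy : ZMod p × ZMod p //
        xy.2 ^ 2 = xy.1 * (xy.1 - 1) * (xy.1 - l)} : ℤ)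
      = p - (-∑ x : ZMod p, quadraticChar (ZMod p) (x * (x - 1) * (x - l))) := by
  classical
  have h2 : ringChar (ZMod p) ≠ 2 := by rwa [ZMod.ringChar_zmod_n]
  have e : Fintype.card {xy : ZMod p × ZMod p // xy.2 ^ 2 = xy.1 * (xy.1 - 1) * (xy.1 - l)}
      = ∑ x : ZMod p, Fintype.card {y : ZMod p // y ^ 2 = x * (x - 1) * (x - l)} := by
    rw [← Fintype.card_sigma]
    exact Fintype.card_congr
      { toFun := fun z => ⟨z.1.1, z.1.2, z.2⟩
        invFun := fun z => ⟨(z.1, z.2.1), z.2.2⟩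
        left_inv := fun z => rfl
        right_inv := fun z => rfl }
  have h : ∀ x : ZMod p, (Fintype.card {y : ZMod p // y ^ 2 = x * (x - 1) * (x - l)} : ℤ)
      = quadraticChar (ZMod p) (x * (x - 1) * (x - l)) + 1 := by
    intro x
    rw [← quadraticChar_card_sqrts h2, Set.toFinset_card]
    rfl
  rw [e]
  push_cast
  simp only [h]
  rw [Finset.sum_add_distrib]
  simp [ZMod.card]
  ring

end base
end LegendreHasse

theorem legendre_curve_trace_and_hasse (p : ℕ) [Fact p.Prime] (hp : p ≠ 2)
    (l : ZMod p) (h0 : l ≠ 0) (h1 : l ≠ 1) :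
    (Fintype.card {xy : ZMod p × ZMod p //
        xy.2 ^ 2 = xy.1 * (xy.1 - 1) * (xy.1 - l)} : ℤ)
      = p - (-∑ x : ZMod p, quadraticChar (ZMod p) (x * (x - 1) * (x - l))) ∧
    |((-∑ x : ZMod p, quadraticChar (ZMod p) (x * (x - 1) * (x - l)) : ℤ) : ℝ)|
      ≤ 2 * Real.sqrt p := by
  refine ⟨LegendreHasse.point_count hp l, ?_⟩
  have h := LegendreHasse.hasse_core hp l h0 h1
  generalize (-∑ x : ZMod p, quadraticChar (ZMod p) (x * (x - 1) * (x - l)) : ℤ) = a at h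
  have h' : (a : ℝ) ^ 2 ≤ 4 * (p : ℝ) := by exact_mod_cast h
  apply abs_le_of_sq_le_sq _ (by positivity)
  rw [mul_pow, Real.sq_sqrt (by positivity)]
  linarith
end

section
/- Let p be a prime with p ≡ 1 (mod 10). Then there exist integers a, b, c, d with a ≡ 4 (mod 5) and ab = d² − c² − cd such that p = a² + 5b² + 5c² + 5d², and the integer a is unique up to sign. -/
/-- Odd-difference case: four coordinates have parity opposite to the first one. -/
lemma qf_core (p z0 w1 w2 w3 w4 : ℤ) (z1 z2 z3 z4 : ℤ)
    (h1 : z1 = z0 + (2 * w1 + 1)) (h2 : z2 = z0 + (2 * w2 + 1))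
    (h3 : z3 = z0 + (2 * w3 + 1)) (h4 : z4 = z0 + (2 * w4 + 1))
    (hm : z0*z1+z1*z2+z2*z3+z3*z4+z4*z0 = z0*z2+z1*z3+z2*z4+z3*z0+z4*z1)
    (hp : z0^2+z1^2+z2^2+z3^2+z4^2 - (z0*z1+z1*z2+z2*z3+z3*z4+z4*z0) = p) :
    ∃ a b c d : ℤ, a * b = d ^ 2 - c ^ 2 - c * d ∧
      p = a ^ 2 + 5 * b ^ 2 + 5 * c ^ 2 + 5 * d ^ 2 := by
  obtain ⟨q, hq⟩ : ∃ q, q = -(w1*w2+w2*w3+w3*w4-w1*w3-w2*w4-w1*w4) := ⟨_, rfl⟩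
  subst h1 h2 h3 h4
  have hw : w1 = w2 + w3 - w4 - 2*q := by
    have : 2 * (w2 + w3 - w1 - w4) = 4 * q := by rw [hq]; linear_combination hm
    linarith
  subst hw
  refine ⟨-(1+w2+w3-q), -q, w2-w4-q, w3-w4-q, ?_, ?_⟩
  · first | linear_combination hq | linear_combination -hq
  · rw [← hp]; first | linear_combination (-2) * hq | linear_combination 2 * hq

lemma qf_exists_aux (p z0 z1 z2 z3 z4 : ℤ) (hodd : p % 2 = 1)
    (hm : z0*z1+z1*z2+z2*z3+z3*z4+z4*z0 = z0*z2+z1*z3+z2*z4+z3*z0+z4*z1)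
    (hp : z0^2+z1^2+z2^2+z3^2+z4^2 - (z0*z1+z1*z2+z2*z3+z3*z4+z4*z0) = p) :
    ∃ a b c d : ℤ, a * b = d ^ 2 - c ^ 2 - c * d ∧
      p = a ^ 2 + 5 * b ^ 2 + 5 * c ^ 2 + 5 * d ^ 2 := by
  have key : ∀ x0 x1 x2 x3 x4 : ZMod 2,
      x0*x1+x1*x2+x2*x3+x3*x4+x4*x0 = x0*x2+x1*x3+x2*x4+x3*x0+x4*x1 →
      x0^2+x1^2+x2^2+x3^2+x4^2 - (x0*x1+x1*x2+x2*x3+x3*x4+x4*x0) = 1 →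
      (x1 = x0 + 1 ∧ x2 = x0 + 1 ∧ x3 = x0 + 1 ∧ x4 = x0 + 1) ∨
      (x2 = x1 + 1 ∧ x3 = x1 + 1 ∧ x4 = x1 + 1 ∧ x0 = x1 + 1) ∨
      (x3 = x2 + 1 ∧ x4 = x2 + 1 ∧ x0 = x2 + 1 ∧ x1 = x2 + 1) ∨
      (x4 = x3 + 1 ∧ x0 = x3 + 1 ∧ x1 = x3 + 1 ∧ x2 = x3 + 1) ∨
      (x0 = x4 + 1 ∧ x1 = x4 + 1 ∧ x2 = x4 + 1 ∧ x3 = x4 + 1) := by decide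
  have hp2 : ((p : ℤ) : ZMod 2) = 1 := by
    have : ((p : ℤ) : ZMod 2) = ((1 : ℤ) : ZMod 2) := by
      rw [ZMod.intCast_eq_intCast_iff]; exact hodd
    simpa using this
  have lift : ∀ x y : ℤ, (x : ZMod 2) = (y : ZMod 2) + 1 → ∃ w, x = y + (2 * w + 1) := by
    intro x y hxy
    have : ((x : ℤ) : ZMod 2) = ((y + 1 : ℤ) : ZMod 2) := by push_cast; exact hxy
    rw [ZMod.intCast_eq_intCast_iff_dvd_sub] at this
    obtain ⟨k, hk⟩ := this
    push_cast at hk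
    exact ⟨-k, by linarith⟩
  have := key z0 z1 z2 z3 z4 (by exact_mod_cast congrArg (Int.cast : ℤ → ZMod 2) hm)
    (by rw [← hp2, ← hp]; push_cast; ring)
  rcases this with ⟨a1, a2, a3, a4⟩ | ⟨a1, a2, a3, a4⟩ | ⟨a1, a2, a3, a4⟩ | ⟨a1, a2, a3, a4⟩ |
    ⟨a1, a2, a3, a4⟩ <;>
  obtain ⟨w1, h1⟩ := lift _ _ a1 <;> obtain ⟨w2, h2⟩ := lift _ _ a2 <;>
  obtain ⟨w3, h3⟩ := lift _ _ a3 <;> obtain ⟨w4, h4⟩ := lift _ _ a4 <;>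
  exact qf_core p _ w1 w2 w3 w4 _ _ _ _ h1 h2 h3 h4 (by linear_combination hm)
    (by linear_combination hp)

lemma qf_geom {R : Type*} [CommRing R] [IsDomain R] {z : R} (h5 : z ^ 5 = 1) (h1 : z ≠ 1) :
    1 + z + z ^ 2 + z ^ 3 + z ^ 4 = 0 := by
  have : (z - 1) * (1 + z + z ^ 2 + z ^ 3 + z ^ 4) = 0 := by linear_combination h5
  rcases mul_eq_zero.mp this with h | h
  · exact absurd (sub_eq_zero.mp h) h1
  · exact h

lemma qf_adjoin {z : ℂ} (h5 : z ^ 5 = 1) {x : ℂ} (hx : x ∈ Algebra.adjoin ℤ {z}) :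
    ∃ a b c d e : ℤ, x = a + b * z + c * z ^ 2 + d * z ^ 3 + e * z ^ 4 := by
  induction hx using Algebra.adjoin_induction with
  | mem x hx => exact ⟨0, 1, 0, 0, 0, by simp at hx; simp [hx]⟩
  | algebraMap r => exact ⟨r, 0, 0, 0, 0, by simp⟩
  | add x y _ _ hx hy =>
    obtain ⟨a, b, c, d, e, rfl⟩ := hx
    obtain ⟨a', b', c', d', e', rfl⟩ := hy
    exact ⟨a + a', b + b', c + c', d + d', e + e', by push_cast; ring⟩
  | mul x y _ _ hx hy =>
    obtain ⟨a, b, c, d, e, rfl⟩ := hx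
    obtain ⟨a', b', c', d', e', rfl⟩ := hy
    refine ⟨a*a'+b*e'+c*d'+d*c'+e*b', a*b'+b*a'+c*e'+d*d'+e*c', a*c'+b*b'+c*a'+d*e'+e*d',
      a*d'+b*c'+c*b'+d*a'+e*e', a*e'+b*d'+c*c'+d*b'+e*a', ?_⟩
    push_cast
    linear_combination ((b*e'+c*d'+d*c'+e*b') + (c*e'+d*d'+e*c')*z + (d*e'+e*d')*z^2
      + e*e'*z^3 : ℂ) * h5

lemma qf_exists (p : ℕ) (hp : p.Prime) (h : p % 10 = 1) :
    ∃ a b c d : ℤ, a * b = d ^ 2 - c ^ 2 - c * d ∧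
      (p : ℤ) = a ^ 2 + 5 * b ^ 2 + 5 * c ^ 2 + 5 * d ^ 2 := by
  have : Fact p.Prime := ⟨hp⟩
  obtain ⟨z, hz⟩ : ∃ z : ℂ, IsPrimitiveRoot z 5 := ⟨_, Complex.isPrimitiveRoot_exp 5 (by norm_num)⟩
  obtain ⟨χ, hχ⟩ := MulChar.exists_mulChar_orderOf (ZMod p) (n := 5)
    (by rw [ZMod.card]; omega) hz
  have hχ5 : χ ^ 5 = 1 := by rw [← hχ]; exact pow_orderOf_eq_one χ
  have hχ1 : χ ≠ 1 := by
    rintro rfl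
    simp at hχ
  have hχ2 : χ * χ ≠ 1 := by
    rw [← pow_two]
    intro h2
    have := orderOf_dvd_of_pow_eq_one h2
    rw [hχ] at this
    omega
  have hJ := jacobiSum_mul_jacobiSum_inv (F := ZMod p) (F' := ℂ)
    (by rw [ringChar.eq_zero, ZMod.ringChar_zmod_n]; exact hp.ne_zero.symm) hχ1 hχ1 hχ2
  have hconj : jacobiSum χ⁻¹ χ⁻¹ = star (jacobiSum χ χ) := by
    simp only [jacobiSum, star_sum, star_mul', MulChar.star_apply']
  have h5 := hz.pow_eq_one
  have hz1 : z ≠ 1 := hz.ne_one (by norm_num)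
  have hg := qf_geom h5 hz1
  have hstar : star z = z ^ 4 := by
    have h1 : ‖z‖ = 1 := hz.norm'_eq_one (by norm_num)
    have h2 : z * star z = 1 := by
      have := Complex.mul_conj z
      rw [Complex.normSq_eq_norm_sq, h1] at this
      simpa using this
    linear_combination z ^ 4 * h2 - star z * h5
  obtain ⟨a, b, c, d, e, hx⟩ := qf_adjoin h5
    (jacobiSum_mem_algebraAdjoin_of_pow_eq_one hχ5 hχ5 hz)
  rw [hconj, hx, ZMod.card] at hJ
  have hs : star ((a : ℂ) + b * z + c * z ^ 2 + d * z ^ 3 + e * z ^ 4)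
      = a + b * z ^ 4 + c * z ^ 3 + d * z ^ 2 + e * z := by
    simp only [star_add, star_mul', star_pow, hstar, star_intCast]
    linear_combination (c * z ^ 3 + d * (z ^ 7 + z ^ 2) + e * (z ^ 11 + z ^ 6 + z) : ℂ) * h5
  rw [hs] at hJ
  obtain ⟨S, hS⟩ : ∃ S : ℤ, S = a^2+b^2+c^2+d^2+e^2 := ⟨_, rfl⟩
  obtain ⟨m, hm⟩ : ∃ m : ℤ, m = a*b+b*c+c*d+d*e+e*a := ⟨_, rfl⟩
  obtain ⟨n, hn⟩ : ∃ n : ℤ, n = a*c+b*d+c*e+d*a+e*b := ⟨_, rfl⟩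
  have hE : (S : ℂ) + m * (z + z ^ 4) + n * (z ^ 2 + z ^ 3) = p := by
    rw [← hJ, hS, hm, hn]
    push_cast
    linear_combination (-((b^2+c^2+d^2+e^2)+(c*b+d*c+e*d)*z+(d*b+e*c)*z^2+e*b*z^3) : ℂ) * h5
  have hw : (2 * (z + z ^ 4) + 1) ^ 2 = 5 := by
    linear_combination 4 * hg + (4 * z ^ 3 + 8) * h5
  have hE2 : ((2 * ((p : ℤ) - S + n) + (m - n) : ℤ) : ℂ) ^ 2 = 5 * ((m - n : ℤ) : ℂ) ^ 2 := by
    have h0 : ((2 * ((p : ℤ) - S + n) + (m - n) : ℤ) : ℂ)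
        = ((m - n : ℤ) : ℂ) * (2 * (z + z ^ 4) + 1) := by
      push_cast
      linear_combination (-2) * hE + 2 * n * hg
    rw [h0, mul_pow, hw]; ring
  have hE3 : (2 * ((p : ℤ) - S + n) + (m - n)) ^ 2 = 5 * (m - n) ^ 2 := by exact_mod_cast hE2
  have hmn : m - n = 0 := by
    by_contra hne
    have hirr : Irrational (Real.sqrt 5) := by
      exact_mod_cast (Nat.Prime.irrational_sqrt (p := 5) (by norm_num))
    apply (irrational_iff_ne_rational _).mp hirr
      |(2 * ((p : ℤ) - S + n) + (m - n))| |m - n| (by simpa using hne)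
    have h3 : ((2 * ((p : ℤ) - S + n) + (m - n) : ℤ) : ℝ) ^ 2 = 5 * ((m - n : ℤ) : ℝ) ^ 2 := by
      exact_mod_cast hE3
    have hne' : ((m - n : ℤ) : ℝ) ≠ 0 := by exact_mod_cast hne
    rw [Int.cast_abs, Int.cast_abs, ← abs_div, ← Real.sqrt_sq_eq_abs, div_pow, h3,
      mul_div_assoc, div_self (pow_ne_zero 2 hne'), mul_one]
  have hSp : S - m = p := by
    rw [hmn] at hE3
    have : 2 * ((p : ℤ) - S + n) + 0 = 0 := by
      apply pow_eq_zero_iff (two_ne_zero) |>.mp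
      rw [hE3]; ring
    linarith
  apply qf_exists_aux (p : ℤ) a b c d e (by omega)
  · rw [← hm, ← hn]; linarith
  · rw [← hm, ← hS]; exact hSp

/-- Equality case of Cauchy-Schwarz. -/
lemma qf_cs (p a b c d a' b' c' d' : ℤ) (hp0 : 0 < p)
    (h : p = a ^ 2 + 5 * b ^ 2 + 5 * c ^ 2 + 5 * d ^ 2)
    (h' : p = a' ^ 2 + 5 * b' ^ 2 + 5 * c' ^ 2 + 5 * d' ^ 2)
    (ha : a % 5 = 4) (ha' : a' % 5 = 4)
    (hd : p ∣ a * a' + 5 * (b * b') + 5 * (c * c') + 5 * (d * d')) : a' = a ∨ a' = -a := by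
  obtain ⟨k, hk⟩ := hd
  have hk0 : k ≠ 0 := by
    rintro rfl
    have : (a * a') % 5 = 0 := by omega
    rw [Int.mul_emod, ha, ha'] at this
    omega
  have hle : k ≤ 1 := by
    by_contra hc
    nlinarith [sq_nonneg (a - a'), sq_nonneg (b - b'), sq_nonneg (c - c'), sq_nonneg (d - d')]
  have hge : -1 ≤ k := by
    by_contra hc
    nlinarith [sq_nonneg (a + a'), sq_nonneg (b + b'), sq_nonneg (c + c'), sq_nonneg (d + d')]
  have : k = 1 ∨ k = -1 := by omega
  rcases this with rfl | rfl
  · left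
    have : (a' - a) ^ 2 = 0 := by
      nlinarith [sq_nonneg (a - a'), sq_nonneg (b - b'), sq_nonneg (c - c'), sq_nonneg (d - d')]
    have := pow_eq_zero_iff (two_ne_zero) |>.mp this
    linarith
  · right
    have : (a' + a) ^ 2 = 0 := by
      nlinarith [sq_nonneg (a + a'), sq_nonneg (b + b'), sq_nonneg (c + c'), sq_nonneg (d + d')]
    have := pow_eq_zero_iff (two_ne_zero) |>.mp this
    linarith

/-- Over a field with a primitive fifth root of unity the variety splits into four planes. -/
lemma qf_field {F : Type*} [Field F] (h2 : (2 : F) ≠ 0) (t s r a b c d a' b' c' d' : F)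
    (ht : t ^ 2 = 5) (hs : s ^ 2 = -5 - 2 * t) (hr : r ^ 2 = -5 + 2 * t) (hsr : s * r = -t)
    (h1 : a * b = d ^ 2 - c ^ 2 - c * d) (h : a ^ 2 + 5 * b ^ 2 + 5 * c ^ 2 + 5 * d ^ 2 = 0)
    (h1' : a' * b' = d' ^ 2 - c' ^ 2 - c' * d')
    (h' : a' ^ 2 + 5 * b' ^ 2 + 5 * c' ^ 2 + 5 * d' ^ 2 = 0) :
    a * a' + 5 * (b * b') + 5 * (c * c') + 5 * (d * d') = 0 ∨
    a * a' + 5 * (b * b') - 5 * (c * c') - 5 * (d * d') = 0 ∨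
    a * a' - 5 * (b * b') + 5 * (c * d') - 5 * (d * c') = 0 ∨
    a * a' - 5 * (b * b') - 5 * (c * d') + 5 * (d * c') = 0 := by
  have split : ∀ a b c d : F, a * b = d ^ 2 - c ^ 2 - c * d →
      a ^ 2 + 5 * b ^ 2 + 5 * c ^ 2 + 5 * d ^ 2 = 0 →
      (a + b * t = c * s + d * r ∨ a + b * t = -(c * s + d * r)) ∧
      (a - b * t = c * r - d * s ∨ a - b * t = -(c * r - d * s)) := by
    intro a b c d h1 h
    constructor
    · apply sq_eq_sq_iff_eq_or_eq_neg.mp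
      linear_combination h + 2 * t * h1 + b ^ 2 * ht - c ^ 2 * hs - d ^ 2 * hr - 2 * c * d * hsr
    · apply sq_eq_sq_iff_eq_or_eq_neg.mp
      linear_combination h - 2 * t * h1 + b ^ 2 * ht - c ^ 2 * hr - d ^ 2 * hs + 2 * c * d * hsr
  obtain ⟨e1, e2⟩ := split a b c d h1 h
  obtain ⟨f1, f2⟩ := split a' b' c' d' h1' h'
  have hp : ∀ x : F, 2 * x = 0 → x = 0 := fun x hx => (mul_eq_zero.mp hx).resolve_left h2
  have hU : (c * s + d * r) * (c' * s + d' * r) + (c * r - d * s) * (c' * r - d' * s)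
      = -10 * (c * c' + d * d') := by
    linear_combination (c * c' + d * d') * (hs + hr)
  have hV : (c * s + d * r) * (c' * r - d' * s) - (c * r - d * s) * (c' * s + d' * r)
      = 10 * (c * d' - d * c') := by
    linear_combination (d * c' - c * d') * (hs + hr)
  have P : 2 * (a * a' + 5 * (b * b')) =
      (a + b * t) * (a' + b' * t) + (a - b * t) * (a' - b' * t) := by
    linear_combination (-2 * b * b') * ht
  have M : 2 * (a * a' - 5 * (b * b')) =
      (a + b * t) * (a' - b' * t) + (a - b * t) * (a' + b' * t) := by
    linear_combination (2 * b * b') * ht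
  rcases e1 with e1 | e1 <;> rcases e2 with e2 | e2 <;> rcases f1 with f1 | f1 <;>
    rcases f2 with f2 | f2 <;> rw [e1, e2, f1, f2] at P M <;>
  first
  | (left; apply hp; linear_combination P + hU)
  | (right; left; apply hp; linear_combination P - hU)
  | (right; right; left; apply hp; linear_combination M + hV)
  | (right; right; left; apply hp; linear_combination M - hV)
  | (right; right; right; apply hp; linear_combination M + hV)

lemma qf_unique (p : ℕ) (hp : p.Prime) (h : p % 10 = 1) (a b c d a' b' c' d' : ℤ)
    (ha : a % 5 = 4) (h1 : a * b = d ^ 2 - c ^ 2 - c * d)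
    (hq : (p : ℤ) = a ^ 2 + 5 * b ^ 2 + 5 * c ^ 2 + 5 * d ^ 2)
    (ha' : a' % 5 = 4) (h1' : a' * b' = d' ^ 2 - c' ^ 2 - c' * d')
    (hq' : (p : ℤ) = a' ^ 2 + 5 * b' ^ 2 + 5 * c' ^ 2 + 5 * d' ^ 2) : a' = a ∨ a' = -a := by
  have : Fact p.Prime := ⟨hp⟩
  have : Fact (Nat.Prime 5) := ⟨by norm_num⟩
  obtain ⟨u, hu⟩ := exists_prime_orderOf_dvd_card (G := (ZMod p)ˣ) 5
    (by rw [ZMod.card_units]; omega)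
  obtain ⟨z, hz⟩ : ∃ z : ZMod p, z = u := ⟨_, rfl⟩
  have h5 : z ^ 5 = 1 := by
    rw [hz, ← Units.val_pow_eq_pow_val, ← hu, pow_orderOf_eq_one, Units.val_one]
  have hz1 : z ≠ 1 := by
    intro hh
    rw [hz, Units.val_eq_one] at hh
    rw [hh] at hu
    simp at hu
  have hg := qf_geom h5 hz1
  have h2 : (2 : ZMod p) ≠ 0 := by
    intro hh
    have : ((2 : ℕ) : ZMod p) = 0 := by exact_mod_cast hh
    rw [ZMod.natCast_eq_zero_iff] at this
    have := Nat.le_of_dvd (by norm_num) this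
    have := hp.two_le
    omega
  have c1 := congrArg (Int.cast : ℤ → ZMod p) h1
  have c2 := congrArg (Int.cast : ℤ → ZMod p) hq
  have c1' := congrArg (Int.cast : ℤ → ZMod p) h1'
  have c2' := congrArg (Int.cast : ℤ → ZMod p) hq'
  push_cast at c1 c2 c1' c2'
  rw [ZMod.natCast_self] at c2 c2'
  have hp0 : (0 : ℤ) < p := by exact_mod_cast hp.pos
  have z4 : z ^ 4 = -(1 + z + z ^ 2 + z ^ 3) := by linear_combination hg
  have key := qf_field h2 (1 + 2 * (z + z ^ 4)) (z + z ^ 2 - z ^ 3 - z ^ 4)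
    (z - z ^ 2 + z ^ 3 - z ^ 4) a b c d a' b' c' d'
    (by linear_combination 4 * hg + (4 * z ^ 3 + 8) * h5)
    (by linear_combination 3 * hg + (-4 - z + 2*z^2 + z^3) * h5)
    (by linear_combination -hg + (-4 + 3*z - 2*z^2 + z^3) * h5)
    (by linear_combination hg + (-z + z^3) * h5)
    c1 c2.symm c1' c2'.symm
  have dv : ∀ x : ℤ, (x : ZMod p) = 0 → (p : ℤ) ∣ x := fun x hx =>
    (ZMod.intCast_zmod_eq_zero_iff_dvd x p).mp hx
  rcases key with k | k | k | k
  · exact qf_cs p a b c d a' b' c' d' hp0 hq hq' ha ha' (dv _ (by push_cast; linear_combination k))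
  · exact qf_cs p a b c d a' b' (-c') (-d') hp0 hq (by linear_combination hq') ha ha'
      (dv _ (by push_cast; linear_combination k))
  · exact qf_cs p a b c d a' (-b') d' (-c') hp0 hq (by linear_combination hq') ha ha'
      (dv _ (by push_cast; linear_combination k))
  · exact qf_cs p a b c d a' (-b') (-d') c' hp0 hq (by linear_combination hq') ha ha'
      (dv _ (by push_cast; linear_combination k))

theorem quaternary_form_rep (p : ℕ) (hp : p.Prime) (h : p % 10 = 1) :
    ∃ a b c d : ℤ, a % 5 = 4 ∧ a * b = d ^ 2 - c ^ 2 - c * d ∧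
      (p : ℤ) = a ^ 2 + 5 * b ^ 2 + 5 * c ^ 2 + 5 * d ^ 2 ∧
      ∀ a' b' c' d' : ℤ, a' % 5 = 4 → a' * b' = d' ^ 2 - c' ^ 2 - c' * d' →
        (p : ℤ) = a' ^ 2 + 5 * b' ^ 2 + 5 * c' ^ 2 + 5 * d' ^ 2 →
        a' = a ∨ a' = -a := by
  obtain ⟨a, b, c, d, h1, hq⟩ := qf_exists p hp h
  have hmod : a % 5 = 4 ∨ (-a) % 5 = 4 := by
    have h5 : (a ^ 2) % 5 = 1 := by omega
    have : a % 5 = 0 ∨ a % 5 = 1 ∨ a % 5 = 2 ∨ a % 5 = 3 ∨ a % 5 = 4 := by omega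
    rcases this with h0 | h0 | h0 | h0 | h0 <;> rw [pow_two, Int.mul_emod, h0] at h5 <;> omega
  rcases hmod with ha | ha
  · exact ⟨a, b, c, d, ha, h1, hq, fun a' b' c' d' ha' h1' hq' =>
      qf_unique p hp h a b c d a' b' c' d' ha h1 hq ha' h1' hq'⟩
  · have h1n : -a * -b = d ^ 2 - c ^ 2 - c * d := by linear_combination h1
    have hqn : (p : ℤ) = (-a) ^ 2 + 5 * (-b) ^ 2 + 5 * c ^ 2 + 5 * d ^ 2 := by
      linear_combination hq
    exact ⟨-a, -b, c, d, ha, h1n, hqn, fun a' b' c' d' ha' h1' hq' =>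
      qf_unique p hp h (-a) (-b) c d a' b' c' d' ha h1n hqn ha' h1' hq'⟩
end
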